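/- arXiv:2308.08293 — 4 statements merged into one kernel-verified Lean document; each statement's English description precedes it below -/
import Mathlib

section
/- If a set w of infinitary propositional formulas in negation normal form has a model, i.e. there is a valuation satisfying every formula in w, then Player II has a winning strategy in the model-existence game G(w). -/
universe u

/-- Infinitary propositional formulas in negation normal form over letters `L`. -/
inductive NNF (L : Type u) : Type (u + 1)
  | pos (p : L) : NNF L
  | neg (p : L) : NNF L
  | conj (I : Type u) (f : I → NNF L) : NNF L
  | disj (I : Type u) (f : I → NNF L) : NNF L

/-- Satisfaction of a formula by a valuation `μ : L → Bool`. -/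
def NNF.Sat {L : Type u} (μ : L → Bool) : NNF L → Prop
  | .pos p => μ p = true
  | .neg p => μ p = false
  | .conj _ f => ∀ i, NNF.Sat μ (f i)
  | .disj _ f => ∃ i, NNF.Sat μ (f i)

/-- The subformula closure of a set of formulas: the smallest superset closed under
passing from a conjunction or disjunction to each immediate subformula. -/
inductive SubCl {L : Type u} (w : Set (NNF L)) : NNF L → Prop
  | base {φ : NNF L} : φ ∈ w → SubCl w φ
  | conj {I : Type u} {f : I → NNF L} (i : I) : SubCl w (NNF.conj I f) → SubCl w (f i)
  | disj {I : Type u} {f : I → NNF L} (i : I) : SubCl w (NNF.disj I f) → SubCl w (f i)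

/-- A challenge (move of Player I) in the model-existence game:  a disjunction,
a conjunction together with a conjunct index, or a dummy move. -/
inductive Challenge (L : Type u) : Type (u + 1)
  | pass : Challenge L
  | disj (I : Type u) (f : I → NNF L) : Challenge L
  | conj (I : Type u) (f : I → NNF L) (i : I) : Challenge L

/-- `Answers prev Q next` expresses that `next` is a legal answer of Player II to the
challenge `Q` of Player I, when the previously accumulated set of formulas is `prev`. -/
def Answers {L : Type u} (prev : Set (NNF L)) (Q : Challenge L) (next : Set (NNF L)) : Prop :=
  prev ⊆ next ∧
  match Q with
  | .pass => True
  | .disj I f => NNF.disj I f ∈ prev → ∃ i, f i ∈ next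
  | .conj I f i => NNF.conj I f ∈ prev → f i ∈ next

/-- A strategy for Player II: given the challenges played by Player I so far
(in rounds `0,…,n`), produce the answer `w_n`. -/
def IIStrat (L : Type u) := List (Challenge L) → Set (NNF L)

/-- The answer `w_n` of Player II following strategy `σ` against the play `f` of Player I. -/
def playII {L : Type u} (σ : IIStrat L) (f : ℕ → Challenge L) (n : ℕ) : Set (NNF L) :=
  σ (List.ofFn fun i : Fin (n + 1) => f i)

/-- The set `w_{n-1}` (with `w_{-1} = w`) preceding round `n`. -/
def prevII {L : Type u} (w : Set (NNF L)) (σ : IIStrat L) (f : ℕ → Challenge L) :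
    ℕ → Set (NNF L)
  | 0 => w
  | n + 1 => playII σ f n

/-- A set of formulas contains no atom together with its negation. -/
def ConsistentSet {L : Type u} (s : Set (NNF L)) : Prop :=
  ∀ p : L, ¬ (NNF.pos p ∈ s ∧ NNF.neg p ∈ s)

/-- Player II has a winning strategy in the model-existence game `G(w)`. -/
def WinII {L : Type u} (w : Set (NNF L)) : Prop :=
  ∃ σ : IIStrat L, ∀ f : ℕ → Challenge L,
    (∀ n : ℕ, Answers (prevII w σ f n) (f n) (playII σ f n)) ∧
    ConsistentSet (⋃ n : ℕ, playII σ f n)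

/-- A strategy for Player I: given the answers of Player II in the previous rounds,
produce the next challenge. -/
def IStrat (L : Type u) := List (Set (NNF L)) → Challenge L

/-- The challenge played by Player I in round `n` following strategy `τ` against
the answers `g` of Player II. -/
def movesI {L : Type u} (τ : IStrat L) (g : ℕ → Set (NNF L)) (n : ℕ) : Challenge L :=
  τ (List.ofFn fun i : Fin n => g i)

/-- The set `w_{n-1}` (with `w_{-1} = w`) preceding round `n`, given the answers `g`. -/
def prevSet {L : Type u} (w : Set (NNF L)) (g : ℕ → Set (NNF L)) : ℕ → Set (NNF L)
  | 0 => w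
  | n + 1 => g n

/-- Player I has a winning strategy in the model-existence game `G(w)`. -/
def WinI {L : Type u} (w : Set (NNF L)) : Prop :=
  ∃ τ : IStrat L, ∀ g : ℕ → Set (NNF L),
    (∀ n : ℕ, Answers (prevSet w g n) (movesI τ g n) (g n)) →
    ¬ ConsistentSet (⋃ n : ℕ, g n)

/-- The subformulas of a single formula `φ`. -/
def Subformulas {L : Type u} (φ : NNF L) : Set (NNF L) := {ψ | SubCl {φ} ψ}

/-- A condition in the poset `H(φ)`: a finite set `w` with `φ ∈ w ⊆ φ↓` such that
Player II wins `G(w)`. -/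
def HCond {L : Type u} (φ : NNF L) (w : Set (NNF L)) : Prop :=
  φ ∈ w ∧ w ⊆ Subformulas φ ∧ w.Finite ∧ WinII w

/-- A filter on the poset `H(φ)` (ordered by reverse inclusion): a nonempty,
downward directed (i.e. directed towards stronger common extensions), upward closed
set of conditions. -/
def HFilter {L : Type u} (φ : NNF L) (g : Set (Set (NNF L))) : Prop :=
  g.Nonempty ∧ (∀ w ∈ g, HCond φ w) ∧
  (∀ w ∈ g, ∀ z ∈ g, ∃ v ∈ g, w ⊆ v ∧ z ⊆ v) ∧
  (∀ w ∈ g, ∀ z, HCond φ z → z ⊆ w → z ∈ g)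

/-- if `w` has a model, then Player II has a winning strategy in `G(w)`. -/
theorem stmt1 {L : Type u} (w : Set (NNF L))
    (hmodel : ∃ μ : L → Bool, ∀ ψ ∈ w, NNF.Sat μ ψ) :
    WinII w := by
  obtain ⟨μ, hμ⟩ := hmodel
  -- Player II always plays the set of all formulas true under `μ`.
  refine ⟨fun _ => {ψ | NNF.Sat μ ψ}, fun f => ⟨fun n => ?_, ?_⟩⟩
  · have hprev : ∀ ψ ∈ prevII w (fun _ => {ψ | NNF.Sat μ ψ}) f n, NNF.Sat μ ψ := by
      cases n with
      | zero => exact hμ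
      | succ n => exact fun ψ h => h
    refine ⟨hprev, ?_⟩
    cases f n with
    | pass => trivial
    | disj I g =>
      intro h
      have h2 := hprev _ h
      simp only [NNF.Sat] at h2
      exact h2
    | conj I g i =>
      intro h
      have h2 := hprev _ h
      simp only [NNF.Sat] at h2
      exact h2 i
  · rintro p ⟨h1, h2⟩
    obtain ⟨_, h1⟩ := Set.mem_iUnion.1 h1
    obtain ⟨_, h2⟩ := Set.mem_iUnion.1 h2
    change NNF.Sat μ _ at h1 h2
    simp only [NNF.Sat] at h1 h2
    rw [h1] at h2
    cases h2
end

section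
/- Let w be a set of infinitary propositional formulas in negation normal form whose set of subformulas w↓ is countable. If Player II has a winning strategy in the model-existence game G(w), then w has a model, i.e. there is a valuation satisfying every formula in w. -/
universe u

open Classical in
/-- The challenge attached to a pair of formulas: a disjunction is challenged directly, a
conjunction is challenged at an index whose conjunct is the second formula. -/
noncomputable def chalOf {L : Type u} (ψ χ : NNF L) : Challenge L :=
  match ψ with
  | .pos _ => .pass
  | .neg _ => .pass
  | .disj I f => .disj I f
  | .conj I f => if h : ∃ i, f i = χ then .conj I f h.choose else .pass

/-- if the subformula closure of `w` is countable and Player II has a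
winning strategy in `G(w)`, then `w` has a model. -/
theorem stmt2 {L : Type u} (w : Set (NNF L))
    (hcount : {ψ : NNF L | SubCl w ψ}.Countable)
    (hwin : WinII w) :
    ∃ μ : L → Bool, ∀ ψ ∈ w, NNF.Sat μ ψ := by
  classical
  obtain ⟨σ, hσ⟩ := hwin
  rcases Set.eq_empty_or_nonempty w with rfl | ⟨φ₀, hφ₀⟩
  · exact ⟨fun _ => true, fun ψ h => absurd h (Set.notMem_empty ψ)⟩
  obtain ⟨e, he⟩ := hcount.exists_eq_range ⟨φ₀, SubCl.base hφ₀⟩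
  have hsurj : ∀ ψ, SubCl w ψ → ∃ n, e n = ψ := by
    intro ψ hψ
    have h1 : ψ ∈ {ψ : NNF L | SubCl w ψ} := hψ
    rw [he] at h1
    exact h1
  let F : ℕ → Challenge L := fun n =>
    chalOf (e (Nat.unpair (Nat.unpair n).1).1) (e (Nat.unpair (Nat.unpair n).1).2)
  obtain ⟨hans, hcons⟩ := hσ F
  have hmono : Monotone (prevII w σ F) := monotone_nat_of_le_succ fun n => (hans n).1
  set T : Set (NNF L) := ⋃ n : ℕ, playII σ F n with hT
  have hF : ∀ ψ χ, SubCl w ψ → SubCl w χ → ψ ∈ T →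
      ∃ n, F n = chalOf ψ χ ∧ ψ ∈ prevII w σ F n := by
    intro ψ χ hψ hχ hm
    obtain ⟨a, rfl⟩ := hsurj ψ hψ
    obtain ⟨b, rfl⟩ := hsurj χ hχ
    obtain ⟨n, hn⟩ := Set.mem_iUnion.1 hm
    refine ⟨Nat.pair (Nat.pair a b) (n + 1), by simp [F], ?_⟩
    exact hmono (Nat.right_le_pair _ _) (show e a ∈ prevII w σ F (n + 1) from hn)
  have key : ∀ ψ : NNF L, SubCl w ψ → ψ ∈ T →
      NNF.Sat (fun p => decide (NNF.pos p ∈ T)) ψ := by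
    intro ψ
    induction ψ with
    | pos p => intro _ h; simpa [NNF.Sat] using h
    | neg p =>
      intro _ h
      have h2 : NNF.pos p ∉ T := fun h' => hcons p ⟨h', h⟩
      simpa [NNF.Sat] using h2
    | conj I f ih =>
      intro hs h i
      refine ih i (SubCl.conj i hs) ?_
      obtain ⟨n, hn, hp⟩ := hF _ (f i) hs (SubCl.conj i hs) h
      have hex : ∃ j, f j = f i := ⟨i, rfl⟩
      have h3 := (hans n).2
      simp only [hn, chalOf, dif_pos hex] at h3
      have h4 := h3 hp
      rw [hex.choose_spec] at h4
      exact Set.mem_iUnion.2 ⟨n, h4⟩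
    | disj I f ih =>
      intro hs h
      obtain ⟨n, hn, hp⟩ := hF _ _ hs hs h
      have h3 := (hans n).2
      simp only [hn, chalOf] at h3
      obtain ⟨i, hi⟩ := h3 hp
      exact ⟨i, ih i (SubCl.disj i hs) (Set.mem_iUnion.2 ⟨n, hi⟩)⟩
  exact ⟨_, fun ψ hψ => key ψ (SubCl.base hψ) (Set.mem_iUnion.2 ⟨0, (hans 0).1 hψ⟩)⟩
end

section
/- Let w be a set of infinitary propositional formulas in negation normal form whose set of subformulas w↓ is countable. Then Player II has a winning strategy in the model-existence game G(w) if and only if w has a model, i.e. there is a valuation satisfying every formula in w. -/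
universe u

open Classical in
/-- The challenge attached to a pair of formulas: challenge the first one, and, if it is a
conjunction having the second one as a conjunct, ask for that conjunct. -/
noncomputable def challengeOf {L : Type u} : NNF L → NNF L → Challenge L
  | .pos _, _ => .pass
  | .neg _, _ => .pass
  | .disj I f, _ => .disj I f
  | .conj I f, χ => if h : ∃ i, f i = χ then .conj I f h.choose else .pass

theorem winII_of_model {L : Type u} (w : Set (NNF L)) (μ : L → Bool)
    (h : ∀ ψ ∈ w, NNF.Sat μ ψ) : WinII w := by
  refine ⟨fun _ => {ψ | NNF.Sat μ ψ}, fun f => ⟨fun n => ?_, ?_⟩⟩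
  · have hp : prevII w (fun _ => {ψ | NNF.Sat μ ψ}) f n ⊆ {ψ | NNF.Sat μ ψ} := by
      cases n with
      | zero => exact h
      | succ n => exact fun _ hx => hx
    refine ⟨hp, ?_⟩
    cases f n with
    | pass => trivial
    | disj I g =>
      intro hm
      have := hp hm
      simpa [NNF.Sat, playII] using this
    | conj I g i =>
      intro hm
      have := hp hm
      simp only [Set.mem_setOf_eq, NNF.Sat] at this
      exact this i
  · rintro p ⟨h1, h2⟩
    simp only [Set.mem_iUnion, playII, Set.mem_setOf_eq, NNF.Sat] at h1 h2
    obtain ⟨_, h1⟩ := h1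
    obtain ⟨_, h2⟩ := h2
    simp [h1] at h2

theorem model_of_winII {L : Type u} (w : Set (NNF L))
    (hcount : {ψ : NNF L | SubCl w ψ}.Countable) (hw : WinII w) :
    ∃ μ : L → Bool, ∀ ψ ∈ w, NNF.Sat μ ψ := by
  classical
  rcases Set.eq_empty_or_nonempty {ψ : NNF L | SubCl w ψ} with he | hne
  · refine ⟨fun _ => true, fun ψ hψ => ?_⟩
    have : ψ ∈ {ψ : NNF L | SubCl w ψ} := SubCl.base hψ
    rw [he] at this
    exact this.elim
  obtain ⟨e, he⟩ := hcount.exists_eq_range hne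
  have hsurj : ∀ ψ, SubCl w ψ → ∃ n, e n = ψ := fun ψ hψ => by
    have : ψ ∈ Set.range e := he ▸ hψ
    exact this
  obtain ⟨σ, hσ⟩ := hw
  let f : ℕ → Challenge L := fun n =>
    challengeOf (e n.unpair.1.unpair.1) (e n.unpair.1.unpair.2)
  obtain ⟨hans, hcons⟩ := hσ f
  have hmono : Monotone (prevII w σ f) := monotone_nat_of_le_succ fun n => (hans n).1
  -- every challenge is played after every stage
  have hplay : ∀ ψ χ, SubCl w ψ → SubCl w χ → ∀ k, ψ ∈ prevII w σ f k →
      ∃ n, ψ ∈ prevII w σ f n ∧ f n = challengeOf ψ χ := by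
    intro ψ χ hψ hχ k hk
    obtain ⟨a, rfl⟩ := hsurj ψ hψ
    obtain ⟨b, rfl⟩ := hsurj χ hχ
    refine ⟨Nat.pair (Nat.pair a b) k, hmono (Nat.right_le_pair _ _) hk, ?_⟩
    simp [f]
  let μ : L → Bool := fun p => decide (∃ n, NNF.pos p ∈ prevII w σ f n)
  have key : ∀ ψ : NNF L, SubCl w ψ → ∀ k, ψ ∈ prevII w σ f k → NNF.Sat μ ψ := by
    intro ψ
    induction ψ with
    | pos p =>
      intro _ k hk
      simp only [NNF.Sat, μ, decide_eq_true_eq]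
      exact ⟨k, hk⟩
    | neg p =>
      intro _ k hk
      simp only [NNF.Sat, μ, decide_eq_false_iff_not]
      rintro ⟨m, hm⟩
      exact hcons p ⟨Set.mem_iUnion.2 ⟨m, (hans m).1 hm⟩, Set.mem_iUnion.2 ⟨k, (hans k).1 hk⟩⟩
    | conj I g ih =>
      intro hs k hk i
      obtain ⟨n, hn, hf⟩ := hplay _ (g i) hs (SubCl.conj i hs) k hk
      have hex : ∃ j, g j = g i := ⟨i, rfl⟩
      have ha := (hans n).2
      rw [hf, challengeOf, dif_pos hex] at ha
      have hm := ha hn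
      rw [hex.choose_spec] at hm
      exact ih i (SubCl.conj i hs) (n + 1) hm
    | disj I g ih =>
      intro hs k hk
      obtain ⟨n, hn, hf⟩ := hplay _ _ hs hs k hk
      have ha := (hans n).2
      rw [hf, challengeOf] at ha
      obtain ⟨i, hi⟩ := ha hn
      exact ⟨i, ih i (SubCl.disj i hs) (n + 1) hi⟩
  exact ⟨μ, fun ψ hψ => key ψ (SubCl.base hψ) 0 hψ⟩

/-- for `w` with countable subformula closure, Player II has a winning
strategy in `G(w)` if and only if `w` has a model. -/
theorem stmt3 {L : Type u} (w : Set (NNF L))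
    (hcount : {ψ : NNF L | SubCl w ψ}.Countable) :
    WinII w ↔ ∃ μ : L → Bool, ∀ ψ ∈ w, NNF.Sat μ ψ := by
  exact ⟨model_of_winII w hcount, fun ⟨μ, h⟩ => winII_of_model w μ h⟩
end

section
/- Let φ be an infinitary propositional formula in negation normal form and let H(φ) be the poset of conditions for φ. Then: (i) for every disjunction ψ = ⋁_{i∈I} ψ_i in φ↓, the set D_ψ = {w ∈ H(φ) : ψ ∉ w, or ψ_i ∈ w for some i ∈ I} is dense in H(φ) (every condition has an extension in D_ψ); and (ii) for every conjunction ψ = ⋀_{i∈I} ψ_i in φ↓ and every i ∈ I, the set D_{ψ,i} = {w ∈ H(φ) : ψ ∉ w, or ψ_i ∈ w} is dense in H(φ). -/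
universe u

theorem Answers.mono_prev {L : Type u} {a b c : Set (NNF L)} {Q : Challenge L}
    (hab : a ⊆ b) (h : Answers b Q c) : Answers a Q c := by
  refine ⟨hab.trans h.1, ?_⟩
  have h2 := h.2
  cases Q with
  | pass => trivial
  | disj I f => exact fun hm => h2 (hab hm)
  | conj I f i => exact fun hm => h2 (hab hm)

/-- Player I's play `Q, f 0, f 1, …`. -/
def consPlay {L : Type u} (Q : Challenge L) (f : ℕ → Challenge L) : ℕ → Challenge L
  | 0 => Q
  | n + 1 => f n

theorem playII_consPlay {L : Type u} (σ : IIStrat L) (Q : Challenge L)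
    (f : ℕ → Challenge L) (n : ℕ) :
    playII σ (consPlay Q f) (n + 1) = playII (fun l => σ (Q :: l)) f n := by
  unfold playII
  rw [List.ofFn_succ]
  rfl

theorem WinII.step {L : Type u} {w : Set (NNF L)} (h : WinII w) (Q : Challenge L) :
    ∃ v : Set (NNF L), Answers w Q v ∧ ∀ z, z ⊆ v → WinII z := by
  obtain ⟨σ, hσ⟩ := h
  refine ⟨σ [Q], ?_, ?_⟩
  · exact (hσ (consPlay Q fun _ => Challenge.pass)).1 0
  · intro z hz
    refine ⟨fun l => σ (Q :: l), fun f => ?_⟩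
    obtain ⟨h1, h2⟩ := hσ (consPlay Q f)
    constructor
    · intro n
      have h3 := h1 (n + 1)
      rw [playII_consPlay] at h3
      cases n with
      | zero => exact h3.mono_prev hz
      | succ n =>
        change Answers (playII σ (consPlay Q f) (n + 1)) _ _ at h3
        rw [playII_consPlay] at h3
        exact h3
    · have hsub : (⋃ n : ℕ, playII (fun l => σ (Q :: l)) f n) ⊆
          ⋃ n : ℕ, playII σ (consPlay Q f) n := by
        refine Set.iUnion_subset fun n => ?_
        rw [← playII_consPlay]
        exact Set.subset_iUnion (fun n => playII σ (consPlay Q f) n) (n + 1)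
      exact fun p hp => h2 p ⟨hsub hp.1, hsub hp.2⟩

theorem HCond.insert_of {L : Type u} {φ χ : NNF L} {w v : Set (NNF L)} (hw : HCond φ w)
    (hχ : SubCl {φ} χ) (hwv : w ⊆ v) (hv : χ ∈ v) (hz : ∀ z, z ⊆ v → WinII z) :
    HCond φ (insert χ w) :=
  ⟨Or.inr hw.1, Set.insert_subset hχ hw.2.1, hw.2.2.1.insert χ,
    hz _ (Set.insert_subset hv hwv)⟩

/-- for every disjunction `ψ = ⋁_{i ∈ I} f i` in `φ↓`, the set
`D_ψ = {w ∈ H(φ) : ψ ∉ w ∨ ∃ i, f i ∈ w}` is dense in `H(φ)`, and for every conjunction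
`ψ = ⋀_{i ∈ I} f i` in `φ↓` and every `i ∈ I`, the set `D_{ψ,i} = {w ∈ H(φ) : ψ ∉ w ∨ f i ∈ w}`
is dense in `H(φ)`. -/
theorem stmt7 {L : Type u} (φ : NNF L) :
    (∀ (I : Type u) (f : I → NNF L), NNF.disj I f ∈ Subformulas φ →
      ∀ w : Set (NNF L), HCond φ w →
        ∃ z : Set (NNF L), HCond φ z ∧ w ⊆ z ∧ (NNF.disj I f ∉ z ∨ ∃ i : I, f i ∈ z)) ∧
    (∀ (I : Type u) (f : I → NNF L) (i : I), NNF.conj I f ∈ Subformulas φ →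
      ∀ w : Set (NNF L), HCond φ w →
        ∃ z : Set (NNF L), HCond φ z ∧ w ⊆ z ∧ (NNF.conj I f ∉ z ∨ f i ∈ z)) := by
  constructor
  · intro I f hsub w hw
    by_cases hm : NNF.disj I f ∈ w
    · obtain ⟨v, ha, hz⟩ := hw.2.2.2.step (Challenge.disj I f)
      obtain ⟨i, hi⟩ := ha.2 hm
      exact ⟨insert (f i) w, hw.insert_of (SubCl.disj i hsub) ha.1 hi hz,
        Set.subset_insert _ _, Or.inr ⟨i, Set.mem_insert _ _⟩⟩
    · exact ⟨w, hw, subset_rfl, Or.inl hm⟩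
  · intro I f i hsub w hw
    by_cases hm : NNF.conj I f ∈ w
    · obtain ⟨v, ha, hz⟩ := hw.2.2.2.step (Challenge.conj I f i)
      exact ⟨insert (f i) w, hw.insert_of (SubCl.conj i hsub) ha.1 (ha.2 hm) hz,
        Set.subset_insert _ _, Or.inr (Set.mem_insert _ _)⟩
    · exact ⟨w, hw, subset_rfl, Or.inl hm⟩
end
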